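/- Let Γ ⊂ P^n, n ≥ 2, be a finite set of d ≥ 4n² + 6n + 1 points in linearly general position over an algebraically closed field of characteristic 0, write d = nq + r + 2 with 0 ≤ r ≤ n−1, and suppose h¹(P^n, I_Γ(q)) > 0. Then Γ is in uniform position if and only if h¹(P^n, I_Γ(q)) = r + 1. -/

import Mathlib

open MvPolynomial Filter
open scoped Classical

attribute [local instance] MvPolynomial.gradedAlgebra

noncomputable section

variable {K : Type} [Field K] {n : ℕ}

/-- The Hilbert function, in degree `m`, of the quotient of the homogeneous
coordinate ring of `ℙ^n_K` by the ideal `I`. -/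
def hilbF (I : Ideal (MvPolynomial (Fin (n+1)) K)) (m : ℕ) : ℕ :=
  Module.finrank K
    ((MvPolynomial.homogeneousSubmodule (Fin (n+1)) K m).map
      (Ideal.Quotient.mkₐ K I).toLinearMap)

/-- The irrelevant maximal ideal `(x_0, …, x_n)`. -/
def irrelevantIdeal (K : Type) [Field K] (n : ℕ) : Ideal (MvPolynomial (Fin (n+1)) K) :=
  Ideal.span (Set.range MvPolynomial.X)

/-- Saturation of a homogeneous ideal with respect to the irrelevant ideal. -/
def saturate (I : Ideal (MvPolynomial (Fin (n+1)) K)) : Ideal (MvPolynomial (Fin (n+1)) K) :=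
  ⨆ k : ℕ, Submodule.colon I ((irrelevantIdeal K n ^ k : Ideal (MvPolynomial (Fin (n+1)) K)) : Submodule (MvPolynomial (Fin (n+1)) K) (MvPolynomial (Fin (n+1)) K))

/-- `I` is the (saturated, homogeneous) ideal of a nonempty finite closed subscheme of
`ℙ^n`, i.e. its Hilbert function is eventually a positive constant. -/
structure IsFiniteSubscheme (I : Ideal (MvPolynomial (Fin (n+1)) K)) : Prop where
  homog : Ideal.IsHomogeneous (MvPolynomial.homogeneousSubmodule (Fin (n+1)) K) I
  saturated : saturate I = I
  finite : ∃ d : ℕ, 0 < d ∧ ∀ᶠ m : ℕ in atTop, hilbF I m = d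

/-- The degree (length) of the finite scheme with ideal `I` : the eventual value of
its Hilbert function. -/
def schemeDeg (I : Ideal (MvPolynomial (Fin (n+1)) K)) : ℕ :=
  if h : ∃ d : ℕ, ∀ᶠ m : ℕ in atTop, hilbF I m = d then h.choose else 0

/-- The Castelnuovo–Mumford regularity of the finite scheme with ideal `I` : the least
`p ≥ 1` such that the scheme is `(p-1)`-normal (for a finite scheme, `p`-regularity is
equivalent to `(p-1)`-normality). -/
def schemeReg (I : Ideal (MvPolynomial (Fin (n+1)) K)) : ℕ :=
  sInf {p : ℕ | 1 ≤ p ∧ ∀ m : ℕ, p - 1 ≤ m → hilbF I m = schemeDeg I}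

/-- `h¹(ℙ^n, I_Γ(q))` for a finite scheme `Γ` and `q ≥ 0`: the failure of `q`-normality,
`deg Γ - h_Γ(q)`. -/
def h1F (I : Ideal (MvPolynomial (Fin (n+1)) K)) (q : ℕ) : ℕ :=
  schemeDeg I - hilbF I q

/-- `J` is the ideal of a `t`-dimensional linear subspace of `ℙ^n`: it is generated by a
space of linear forms of codimension... i.e. of `K`-dimension `n - t`. -/
def IsLinearSubspace (J : Ideal (MvPolynomial (Fin (n+1)) K)) (t : ℕ) : Prop :=
  ∃ W : Submodule K (MvPolynomial (Fin (n+1)) K),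
    W ≤ MvPolynomial.homogeneousSubmodule (Fin (n+1)) K 1 ∧
    Module.finrank K W + t = n ∧
    J = Ideal.span (W : Set (MvPolynomial (Fin (n+1)) K))

/-- The ideal of the scheme-theoretic intersection (defined by the sum of the ideal
sheaves): the saturation of `I + J`. -/
def interIdeal (I J : Ideal (MvPolynomial (Fin (n+1)) K)) : Ideal (MvPolynomial (Fin (n+1)) K) :=
  saturate (I ⊔ J)

/-- The residual scheme `Γ : V`, where `V` is the hypersurface `{f = 0}`, is defined by
the colon ideal `(I_Γ : f)`. -/
def residualIdeal (I : Ideal (MvPolynomial (Fin (n+1)) K)) (f : MvPolynomial (Fin (n+1)) K) :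
    Ideal (MvPolynomial (Fin (n+1)) K) :=
  Submodule.colon I (Ideal.span {f})

/-- `Γ` admits a `(t+2)`-secant `t`-plane. -/
def HasSecantPlane (I : Ideal (MvPolynomial (Fin (n+1)) K)) (t : ℕ) : Prop :=
  ∃ J : Ideal (MvPolynomial (Fin (n+1)) K),
    IsLinearSubspace J t ∧ t + 2 ≤ schemeDeg (interIdeal I J)

/-- `t(Γ)`: the smallest `t` such that `Γ` admits a `(t+2)`-secant `t`-plane. -/
def tInv (I : Ideal (MvPolynomial (Fin (n+1)) K)) : ℕ :=
  sInf {t : ℕ | HasSecantPlane I t}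

/-- `Γ` is in linearly general position if `t(Γ) = n`. -/
def InLinGenPos (I : Ideal (MvPolynomial (Fin (n+1)) K)) : Prop :=
  tInv I = n

/-- `Γ ⊆ ℙ^n` is nondegenerate: `I(Γ)` contains no nonzero linear form. -/
def NondegenerateScheme (I : Ideal (MvPolynomial (Fin (n+1)) K)) : Prop :=
  Submodule.restrictScalars K I ⊓ MvPolynomial.homogeneousSubmodule (Fin (n+1)) K 1 = ⊥

/-- The (projective) dimension of the linear span `⟨Γ⟩` of the scheme with ideal `I`:
`n` minus the number of independent linear forms in `I`. -/
def spanDim (I : Ideal (MvPolynomial (Fin (n+1)) K)) : ℕ :=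
  n - Module.finrank K
    ↥(Submodule.restrictScalars K I ⊓ MvPolynomial.homogeneousSubmodule (Fin (n+1)) K 1)

/-- `Γ ∩ Λ` is nondegenerate as a subscheme of the `t`-plane `Λ`: it is contained in no
`(t-1)`-dimensional linear subspace of `Λ`. -/
def NondegenerateIn (I Λ : Ideal (MvPolynomial (Fin (n+1)) K)) (t : ℕ) : Prop :=
  ∀ J : Ideal (MvPolynomial (Fin (n+1)) K),
    IsLinearSubspace J (t - 1) → Λ ≤ J → ¬ J ≤ interIdeal I Λ

/-- `Γ ∩ Λ` is in linearly general position as a subscheme of the `t`-plane `Λ`: it has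
no `(s+2)`-secant `s`-plane inside `Λ` for any `s < t`. -/
def InLinGenPosIn (I Λ : Ideal (MvPolynomial (Fin (n+1)) K)) (t : ℕ) : Prop :=
  ∀ s : ℕ, s < t → ∀ J : Ideal (MvPolynomial (Fin (n+1)) K),
    IsLinearSubspace J s → Λ ≤ J → schemeDeg (interIdeal I J) ≤ s + 1

/-- `J` is the (saturated) homogeneous ideal of a rational normal curve of degree `t`
in `ℙ^n` : the curve is the image of `ℙ^1` under a parametrization by a basis-spanning
family of binary forms of degree `t`, and `J` is the vanishing ideal of (the affine cone
over) this image. -/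
def IsRNC (t : ℕ) (J : Ideal (MvPolynomial (Fin (n+1)) K)) : Prop :=
  ∃ p : Fin (n+1) → MvPolynomial (Fin 2) K,
    (∀ i, (p i).IsHomogeneous t) ∧
    Submodule.span K (Set.range p) = MvPolynomial.homogeneousSubmodule (Fin 2) K t ∧
    J = ⨅ x : Fin 2 → K,
      RingHom.ker (MvPolynomial.eval (fun i => MvPolynomial.eval x (p i)) :
        MvPolynomial (Fin (n+1)) K →+* K)

/-- `ρ(Γ)`: the maximal length of the intersection of `Γ` with a rational normal curve
(of degree `n`) in `ℙ^n`. -/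
def rhoInv (I : Ideal (MvPolynomial (Fin (n+1)) K)) : ℕ :=
  sSup {e : ℕ | ∃ J : Ideal (MvPolynomial (Fin (n+1)) K),
    IsRNC n J ∧ e = schemeDeg (interIdeal I J)}

/-- The (saturated homogeneous) vanishing ideal of a point of `ℙ^n`. -/
def pointIdeal (P : Projectivization K (Fin (n+1) → K)) : Ideal (MvPolynomial (Fin (n+1)) K) :=
  ⨅ c : K, RingHom.ker
    (MvPolynomial.eval (c • P.rep) : MvPolynomial (Fin (n+1)) K →+* K)

/-- The vanishing ideal of a finite set of points of `ℙ^n`. -/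
def idealOfFinset (S : Finset (Projectivization K (Fin (n+1) → K))) :
    Ideal (MvPolynomial (Fin (n+1)) K) :=
  ⨅ P ∈ S, pointIdeal P

/-- A finite set of points of `ℙ^n` is in uniform position if every subset `Y` has
Hilbert function `h_Y(ℓ) = min {|Y|, h_Γ(ℓ)}`. -/
def UniformPosition (S : Finset (Projectivization K (Fin (n+1) → K))) : Prop :=
  ∀ Y ⊆ S, ∀ ℓ : ℕ, hilbF (idealOfFinset Y) ℓ = min Y.card (hilbF (idealOfFinset S) ℓ)

end

section Interpolation

variable {K ι : Type*} [Field K]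

/-- Restriction of functions to a finite set of points, as an algebra homomorphism. -/
def resHom (K : Type*) [Field K] {ι : Type*} (Y : Finset ι) : (ι → K) →ₐ[K] (Y → K) where
  toFun f y := f y
  map_one' := rfl
  map_mul' _ _ := rfl
  map_zero' := rfl
  map_add' _ _ := rfl
  commutes' _ := rfl

@[simp]
theorem resHom_apply {Y : Finset ι} (f : ι → K) (y : Y) : resHom K Y f y = f y := rfl

/-- The rank of the space of functions `U` restricted to the finite set `Y`. -/
noncomputable def resRank (U : Submodule K (ι → K)) (Y : Finset ι) : ℕ :=
  Module.finrank K (U.map (resHom K Y).toLinearMap)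

/-- `U` separates the points of `Y`: these impose independent conditions on `U`. -/
def Separates (U : Submodule K (ι → K)) (Y : Finset ι) : Prop :=
  ∀ y ∈ Y, ∃ f ∈ U, f y ≠ 0 ∧ ∀ z ∈ Y, z ≠ y → f z = 0

/-- Any `n` points of `S` can be separated from any other point of `S` by an element of `V`. -/
def GeneralPosition (V : Submodule K (ι → K)) (n : ℕ) (S : Finset ι) : Prop :=
  ∀ Z ⊆ S, Z.card ≤ n → ∀ p ∈ S, p ∉ Z → ∃ L ∈ V, (∀ z ∈ Z, L z = 0) ∧ L p ≠ 0

theorem Separates.subset {U : Submodule K (ι → K)} {Y Y' : Finset ι} (h : Separates U Y)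
    (hY : Y' ⊆ Y) : Separates U Y' := fun y hy ↦
  let ⟨f, hf, h1, h2⟩ := h y (hY hy)
  ⟨f, hf, h1, fun z hz ↦ h2 z (hY hz)⟩

theorem Separates.map_eq_top {U : Submodule K (ι → K)} {Y : Finset ι} (h : Separates U Y) :
    U.map (resHom K Y).toLinearMap = ⊤ := by
  rw [eq_top_iff, ← (Pi.basisFun K Y).span_eq, Submodule.span_le]
  rintro _ ⟨y, rfl⟩
  obtain ⟨f, hf, h1, h2⟩ := h y y.2
  refine ⟨(f y)⁻¹ • f, U.smul_mem _ hf, ?_⟩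
  ext z
  by_cases hz : z = y
  · subst hz
    simp [h1]
  · simp [hz, h2 z z.2 (fun h ↦ hz (Subtype.ext h))]

theorem separates_iff_resRank {U : Submodule K (ι → K)} {Y : Finset ι} :
    Separates U Y ↔ resRank U Y = Y.card := by
  constructor
  · intro h
    rw [resRank, h.map_eq_top, finrank_top, Module.finrank_pi, Fintype.card_coe]
  · intro h y hy
    have htop : U.map (resHom K Y).toLinearMap = ⊤ := by
      apply Submodule.eq_top_of_finrank_eq
      rw [← resRank, h, Module.finrank_pi, Fintype.card_coe]
    obtain ⟨f, hf, hfy⟩ : Pi.single (⟨y, hy⟩ : Y) (1 : K) ∈ U.map (resHom K Y).toLinearMap :=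
      htop ▸ Submodule.mem_top
    refine ⟨f, hf, ?_, fun z hz hzy ↦ ?_⟩
    · have := congrFun hfy ⟨y, hy⟩
      simp at this
      simp [this]
    · have := congrFun hfy ⟨z, hz⟩
      rw [Pi.single_eq_of_ne (by simpa using hzy)] at this
      exact this

theorem resRank_le_card (U : Submodule K (ι → K)) (Y : Finset ι) : resRank U Y ≤ Y.card := by
  refine (Submodule.finrank_le _).trans ?_
  rw [Module.finrank_pi, Fintype.card_coe]

theorem resRank_mono (U : Submodule K (ι → K)) {Y Y' : Finset ι} (h : Y ⊆ Y') :
    resRank U Y ≤ resRank U Y' := by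
  have : U.map (resHom K Y).toLinearMap =
      (U.map (resHom K Y').toLinearMap).map (LinearMap.funLeft K K (Set.inclusion h)) := by
    rw [← Submodule.map_comp]
    rfl
  rw [resRank, this]
  exact Submodule.finrank_map_le _ _

theorem Separates.card_le {U : Submodule K (ι → K)} {Y S : Finset ι} (h : Separates U Y)
    (hY : Y ⊆ S) : Y.card ≤ resRank U S :=
  (separates_iff_resRank.1 h).symm.le.trans (resRank_mono U hY)

theorem exists_separates (U : Submodule K (ι → K)) (S : Finset ι) :
    ∃ Y ⊆ S, Separates U Y ∧ Y.card = resRank U S := by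
  obtain ⟨Y, hY, hmax⟩ := (S.powerset.filter (Separates U)).exists_max_image Finset.card
    ⟨∅, by simp [Separates]⟩
  simp only [Finset.mem_filter, Finset.mem_powerset] at hY hmax
  refine ⟨Y, hY.1, hY.2, le_antisymm (hY.2.card_le hY.1) ?_⟩
  have key : ∀ f ∈ U, (∀ y ∈ Y, f y = 0) → ∀ x ∈ S, f x = 0 := by
    intro f hf hfY x hx
    by_contra hfx
    have hxY : x ∉ Y := fun h ↦ hfx (hfY x h)
    have := hmax (insert x Y) ⟨Finset.insert_subset hx hY.1, ?_⟩
    · rw [Finset.card_insert_of_notMem hxY] at this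
      omega
    · intro y hy
      rcases Finset.mem_insert.1 hy with rfl | hy
      · refine ⟨f, hf, hfx, fun z hz hzy ↦ hfY z ?_⟩
        exact (Finset.mem_insert.1 hz).resolve_left hzy
      · obtain ⟨g, hg, h1, h2⟩ := hY.2 y hy
        refine ⟨g - (g x / f x) • f, U.sub_mem hg (U.smul_mem _ hf), ?_, fun z hz hzy ↦ ?_⟩
        · simpa [hfY y hy] using h1
        · rcases Finset.mem_insert.1 hz with rfl | hz
          · simp [hfx]
          · simp [hfY z hz, h2 z hz hzy]
  let φ := (LinearMap.funLeft K K (Set.inclusion hY.1)).domRestrict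
    (U.map (resHom K S).toLinearMap)
  have hφ : Function.Injective φ := by
    rw [injective_iff_map_eq_zero]
    rintro ⟨_, f, hf, rfl⟩ h0
    ext x
    exact key f hf (fun y hy ↦ congrFun h0 ⟨y, hy⟩) x x.2
  have := LinearMap.finrank_le_finrank_of_injective hφ
  rw [Module.finrank_pi] at this
  exact this.trans (Fintype.card_coe Y).le

theorem GeneralPosition.exists_pow {V : Submodule K (ι → K)} {n : ℕ} {S : Finset ι}
    (hV : GeneralPosition V n S) (ℓ : ℕ) :
    ∀ Y ⊆ S, Y.card ≤ n * ℓ → ∀ p ∈ S, p ∉ Y → ∃ f ∈ V ^ ℓ, (∀ y ∈ Y, f y = 0) ∧ f p ≠ 0 := by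
  induction ℓ with
  | zero =>
    intro Y _ hcard p _ _
    have : Y = ∅ := by simpa using hcard
    exact ⟨1, by rw [pow_zero]; exact Submodule.one_le.1 le_rfl, by simp [this], by simp⟩
  | succ ℓ ih =>
    intro Y hY hcard p hp hpY
    obtain ⟨Z, hZ, hZc⟩ := Finset.exists_subset_card_eq (min_le_right n Y.card)
    obtain ⟨L, hL, hL0, hLp⟩ := hV Z (hZ.trans hY) (by omega) p hp (fun h ↦ hpY (hZ h))
    obtain ⟨f, hf, hf0, hfp⟩ := ih (Y \ Z) (Finset.sdiff_subset.trans hY) (by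
      rw [Finset.card_sdiff_of_subset hZ]
      rw [Nat.mul_succ] at hcard
      omega) p hp (fun h ↦ hpY (Finset.sdiff_subset h))
    refine ⟨f * L, pow_succ V ℓ ▸ Submodule.mul_mem_mul hf hL, fun y hy ↦ ?_, mul_ne_zero hfp hLp⟩
    by_cases hyZ : y ∈ Z
    · simp [hL0 y hyZ]
    · simp [hf0 y (Finset.mem_sdiff.2 ⟨hy, hyZ⟩)]

theorem GeneralPosition.separates_pow {V : Submodule K (ι → K)} {n : ℕ} {S : Finset ι}
    (hV : GeneralPosition V n S) (ℓ : ℕ) {Y : Finset ι} (hY : Y ⊆ S) (hcard : Y.card ≤ n * ℓ + 1) :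
    Separates (V ^ ℓ) Y := by
  intro y hy
  obtain ⟨f, hf, hf0, hfy⟩ := hV.exists_pow ℓ (Y.erase y) ((Y.erase_subset y).trans hY)
    (by rw [Finset.card_erase_of_mem hy]; omega) y (hY hy) (by simp)
  exact ⟨f, hf, hfy, fun z hz hzy ↦ hf0 z (Finset.mem_erase.2 ⟨hzy, hz⟩)⟩

theorem GeneralPosition.resRank_succ {V : Submodule K (ι → K)} {n : ℕ} {S : Finset ι}
    (hV : GeneralPosition V n S) (ℓ : ℕ) :
    min S.card (resRank (V ^ ℓ) S + n) ≤ resRank (V ^ (ℓ + 1)) S := by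
  obtain ⟨Y, hYS, hY, hYc⟩ := exists_separates (V ^ ℓ) S
  obtain ⟨Z, hZ, hZc⟩ := Finset.exists_subset_card_eq (min_le_right n (S \ Y).card)
  have hZS : Z ⊆ S := hZ.trans Finset.sdiff_subset
  have hd : Disjoint Y Z := Finset.disjoint_left.2 fun y hy hz ↦ (Finset.mem_sdiff.1 (hZ hz)).2 hy
  have hsep : Separates (V ^ (ℓ + 1)) (Y ∪ Z) := by
    have hF : ∀ p ∈ Y, ∃ F ∈ V ^ (ℓ + 1), F p ≠ 0 ∧ ∀ z ∈ Y ∪ Z, z ≠ p → F z = 0 := by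
      intro p hp
      obtain ⟨f, hf, hfp, hf0⟩ := hY p hp
      obtain ⟨L, hL, hL0, hLp⟩ := hV Z hZS (by omega) p (hYS hp) (Finset.disjoint_left.1 hd hp)
      refine ⟨f * L, pow_succ V ℓ ▸ Submodule.mul_mem_mul hf hL, mul_ne_zero hfp hLp, ?_⟩
      intro z hz hzp
      rcases Finset.mem_union.1 hz with hz | hz
      · simp [hf0 z hz hzp]
      · simp [hL0 z hz]
    intro y hy
    rcases Finset.mem_union.1 hy with hy | hy
    · exact hF y hy
    · choose! F hFm hFp hF0 using hF
      obtain ⟨L, hL, hL0, hLy⟩ := hV (Z.erase y) ((Z.erase_subset y).trans hZS)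
        ((Finset.card_le_card (Z.erase_subset y)).trans (by omega)) y (hZS hy) (by simp)
      have hyY : y ∉ Y := Finset.disjoint_right.1 hd hy
      refine ⟨L ^ (ℓ + 1) - ∑ p ∈ Y, ((L p) ^ (ℓ + 1) / F p p) • F p,
        Submodule.sub_mem _ (Submodule.pow_mem_pow _ hL _)
          (Submodule.sum_mem _ fun p hp ↦ Submodule.smul_mem _ _ (hFm p hp)), ?_, ?_⟩
      · have : ∑ p ∈ Y, (L p ^ (ℓ + 1) / F p p) * F p y = 0 := Finset.sum_eq_zero fun p hp ↦ by
          rw [hF0 p hp y (Finset.mem_union_right _ hy) (fun h ↦ hyY (h ▸ hp)), mul_zero]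
        simpa [this] using hLy
      · intro z hz hzy
        rcases Finset.mem_union.1 hz with hzY | hzZ
        · have : ∑ p ∈ Y, (L p ^ (ℓ + 1) / F p p) * F p z = L z ^ (ℓ + 1) := by
            rw [Finset.sum_eq_single z]
            · exact div_mul_cancel₀ _ (hFp z hzY)
            · intro p hp hpz
              rw [hF0 p hp z hz hpz.symm, mul_zero]
            · exact fun h ↦ absurd hzY h
          simp [this]
        · have : ∑ p ∈ Y, (L p ^ (ℓ + 1) / F p p) * F p z = 0 := Finset.sum_eq_zero fun p hp ↦ by
            rw [hF0 p hp z hz (fun h ↦ Finset.disjoint_left.1 hd hp (h ▸ hzZ)), mul_zero]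
          simp [this, hL0 z (Finset.mem_erase.2 ⟨hzy, hzZ⟩)]
  have h1 := hsep.card_le (Finset.union_subset hYS hZS)
  rw [Finset.card_union_of_disjoint hd, hZc, hYc, Finset.card_sdiff_of_subset hYS, hYc] at h1
  omega

theorem resRank_add_of_forall_separates {V : Submodule K (ι → K)} {S : Finset ι}
    (hV : ∀ ℓ, ∀ Y ⊆ S, Y.card ≤ resRank (V ^ ℓ) S → Separates (V ^ ℓ) Y)
    (k l : ℕ) (hk : 0 < resRank (V ^ k) S) (hl : 0 < resRank (V ^ l) S) :
    min S.card (resRank (V ^ k) S + resRank (V ^ l) S - 1) ≤ resRank (V ^ (k + l)) S := by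
  obtain ⟨T, hTS, hTc⟩ := Finset.exists_subset_card_eq
    (min_le_left S.card (resRank (V ^ k) S + resRank (V ^ l) S - 1))
  have hT : Separates (V ^ (k + l)) T := by
    intro p hp
    obtain ⟨A, hA, hAc⟩ := Finset.exists_subset_card_eq
      (min_le_right (resRank (V ^ k) S - 1) (T.erase p).card)
    have hpA : p ∉ A := fun h ↦ by simpa using hA h
    have hpB : p ∉ T.erase p \ A := by simp
    have hc : (T.erase p).card = T.card - 1 := Finset.card_erase_of_mem hp
    obtain ⟨f, hf, hfp, hf0⟩ := hV k (insert p A)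
      (Finset.insert_subset (hTS hp) (hA.trans ((T.erase_subset p).trans hTS)))
      (by rw [Finset.card_insert_of_notMem hpA]; omega) p (by simp)
    obtain ⟨g, hg, hgp, hg0⟩ := hV l (insert p (T.erase p \ A))
      (Finset.insert_subset (hTS hp) (Finset.sdiff_subset.trans ((T.erase_subset p).trans hTS)))
      (by rw [Finset.card_insert_of_notMem hpB, Finset.card_sdiff_of_subset hA]; omega) p (by simp)
    refine ⟨f * g, pow_add V k l ▸ Submodule.mul_mem_mul hf hg, mul_ne_zero hfp hgp, ?_⟩
    intro z hz hzp
    by_cases hzA : z ∈ A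
    · simp [hf0 z (Finset.mem_insert_of_mem hzA) hzp]
    · simp [hg0 z (Finset.mem_insert_of_mem
        (Finset.mem_sdiff.2 ⟨Finset.mem_erase.2 ⟨hzp, hz⟩, hzA⟩)) hzp]
  exact hTc ▸ hT.card_le hTS

theorem resRank_mul_of_forall_separates {V : Submodule K (ι → K)} {S : Finset ι}
    (hV : ∀ ℓ, ∀ Y ⊆ S, Y.card ≤ resRank (V ^ ℓ) S → Separates (V ^ ℓ) Y)
    (hpos : ∀ ℓ, 0 < resRank (V ^ ℓ) S) {k c : ℕ} (hk : c + 1 ≤ resRank (V ^ k) S) (m : ℕ) :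
    min S.card (m * c + 1) ≤ resRank (V ^ (k * m)) S := by
  induction m with
  | zero =>
    have := hpos (k * 0)
    omega
  | succ m ih =>
    have := resRank_add_of_forall_separates hV (k * m) k (hpos _) (hpos _)
    rw [Nat.mul_succ, Nat.succ_mul]
    omega

end Interpolation

section RationalNormalCurve

variable {K ι : Type*} [Field K]

theorem Separates.eq_zero [Finite ι] {U : Submodule K (ι → K)} {Y : Finset ι}
    (h : Separates U Y) (hU : Module.finrank K U ≤ Y.card) {f : ι → K} (hf : f ∈ U)
    (hY : ∀ y ∈ Y, f y = 0) : f = 0 := by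
  have hsurj : Function.Surjective ((resHom K Y).toLinearMap.domRestrict U) := by
    rw [← LinearMap.range_eq_top, LinearMap.range_domRestrict, h.map_eq_top]
  have hfin : Module.finrank K U = Module.finrank K (Y → K) := by
    have := LinearMap.finrank_le_finrank_of_surjective hsurj
    rw [Module.finrank_pi, Fintype.card_coe] at this ⊢
    omega
  have hinj := (LinearMap.injective_iff_surjective_of_finrank_eq_finrank hfin).2 hsurj
  exact congrArg Subtype.val (@hinj ⟨f, hf⟩ 0 (funext fun y ↦ hY y y.2))

theorem exists_parametrization {w : ℕ → K} {n : ℕ}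
    (hw : ∀ i < n, ∀ j < n, w i * w (j + 1) = w (i + 1) * w j) :
    ∃ c s u : K, ∀ i ≤ n, w i = c * s ^ (n - i) * u ^ i := by
  by_cases h0 : w 0 = 0
  · have hz : ∀ i < n, w i = 0 := by
      intro i
      induction i with
      | zero => exact fun _ ↦ h0
      | succ i ih =>
        intro hi
        have := hw i (by omega) (i + 1) hi
        rw [ih (by omega), zero_mul] at this
        exact mul_self_eq_zero.1 this.symm
    refine ⟨w n, 0, 1, fun i hi ↦ ?_⟩
    rcases hi.lt_or_eq with hi | rfl
    · simp [hz i hi, (Nat.sub_pos_of_lt hi).ne']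
    · simp
  · refine ⟨w 0, 1, w 1 / w 0, fun i hi ↦ ?_⟩
    induction i with
    | zero => simp
    | succ i ih =>
      have h1 := hw 0 (by omega) i (by omega)
      rw [ih (by omega), zero_add] at h1
      apply mul_left_cancel₀ h0
      rw [h1, pow_succ]
      field_simp
      simp

theorem finrank_pow_le_of_minors [Finite ι] {V : Submodule K (ι → K)} {n : ℕ} {w : ℕ → ι → K}
    (hw : ∀ i < n, ∀ j < n, w i * w (j + 1) = w (i + 1) * w j)
    (hV : V ≤ Submodule.span K (w '' Set.Iic n)) (q : ℕ) :
    Module.finrank K (V ^ q : Submodule K (ι → K)) ≤ n * q + 1 := by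
  choose c s u hcsu using fun p : ι ↦ exists_parametrization (w := fun i ↦ w i p) (n := n)
    (fun i hi j hj ↦ congrFun (hw i hi j hj) p)
  have hw' : ∀ i ≤ n, w i = c * s ^ (n - i) * u ^ i := fun i hi ↦ funext fun p ↦ hcsu p i hi
  let G : ℕ → ℕ → ι → K := fun q m ↦ c ^ q * s ^ (n * q - m) * u ^ m
  have hle : ∀ q, V ^ q ≤ Submodule.span K (G q '' Set.Iic (n * q)) := by
    intro q
    induction q with
    | zero =>
      rw [pow_zero, Submodule.one_le]
      exact Submodule.subset_span ⟨0, by simp, by simp [G]⟩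
    | succ q ih =>
      rw [pow_succ]
      refine (mul_le_mul' ih hV).trans ?_
      rw [Submodule.span_mul_span, Submodule.span_le]
      rintro _ ⟨_, ⟨m, hm, rfl⟩, _, ⟨i, hi, rfl⟩, rfl⟩
      simp only [Set.mem_Iic] at hm hi
      refine Submodule.subset_span ⟨m + i, by simp only [Set.mem_Iic, Nat.mul_succ]; omega, ?_⟩
      simp only [G, hw' i hi]
      have : n * (q + 1) - (m + i) = (n * q - m) + (n - i) := by
        rw [Nat.mul_succ]
        omega
      rw [this]
      ring
  refine (Submodule.finrank_mono (hle q)).trans ?_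
  refine (finrank_span_le_card _).trans ?_
  rw [Set.toFinset_card, ← Nat.card_eq_fintype_card]
  refine (Set.ncard_image_le (Set.finite_Iic _)).trans ?_
  simp

variable [Fintype ι] {V : Submodule K (ι → K)} {n : ℕ}

theorem GeneralPosition.eq_zero (hV : GeneralPosition V n Finset.univ)
    (hdim : Module.finrank K V = n + 1) {f : ι → K} (hf : f ∈ V) {Y : Finset ι}
    (hY : n + 1 ≤ Y.card) (h0 : ∀ y ∈ Y, f y = 0) : f = 0 := by
  obtain ⟨Y', hY', hc⟩ := Finset.exists_subset_card_eq hY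
  have := hV.separates_pow 1 (Finset.subset_univ Y') (by omega)
  rw [pow_one] at this
  exact this.eq_zero (by omega) hf fun y hy ↦ h0 y (hY' hy)

theorem GeneralPosition.card_support (hV : GeneralPosition V n Finset.univ)
    (hdim : Module.finrank K V = n + 1) {f : ι → K} (hf : f ∈ V) (h0 : f ≠ 0) :
    Fintype.card ι ≤ (Finset.univ.filter fun x ↦ f x ≠ 0).card + n := by
  by_contra! h
  refine h0 (hV.eq_zero hdim hf (Y := Finset.univ.filter fun x ↦ f x = 0) ?_ (by simp))
  have : (Finset.univ.filter fun x ↦ f x = 0).card + (Finset.univ.filter fun x ↦ f x ≠ 0).card =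
      Fintype.card ι := by
    convert Finset.card_filter_add_card_filter_not (s := Finset.univ) (fun x ↦ f x = 0)
    exact Finset.card_univ.symm
  omega

/-- If two elements `a, b` of `V` vanish on `n - 1` common points and the products of elements of
`V` satisfy the minimal dimension bound, then any subspace `T` of `V` has a subspace of `V` of
dimension at least `dim T - 1` which is mapped into `T` by multiplication by `b / a`. -/
theorem GeneralPosition.exists_submodule (hV : GeneralPosition V n Finset.univ)
    (hdim : Module.finrank K V = n + 1)
    (h2 : Module.finrank K (V ^ 2 : Submodule K (ι → K)) ≤ 2 * n + 1)
    (hcard : 2 * n + 1 ≤ Fintype.card ι) {Z : Finset ι} (hZ : Z.card + 1 = n) {a b : ι → K}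
    (ha : a ∈ V) (hb : b ∈ V) (ha0 : a ≠ 0) (haZ : ∀ z ∈ Z, a z = 0) (hbZ : ∀ z ∈ Z, b z = 0)
    {T : Submodule K (ι → K)} (hT : T ≤ V) :
    ∃ T' ≤ V, Module.finrank K T ≤ Module.finrank K T' + 1 ∧
      ∀ g ∈ T', ∃ f ∈ T, b * g = a * f := by
  let φ : (V × T) →ₗ[K] (ι → K) :=
    (LinearMap.mulLeft K b ∘ₗ V.subtype) ∘ₗ LinearMap.fst K V T -
      (LinearMap.mulLeft K a ∘ₗ T.subtype) ∘ₗ LinearMap.snd K V T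
  have hφ : ∀ x, φ x = b * x.1 - a * x.2 := fun x ↦ rfl
  let ρ := (resHom K Z).toLinearMap.domRestrict (V ^ 2)
  have hρ : Module.finrank K (LinearMap.range ρ) = Z.card := by
    rw [LinearMap.range_domRestrict]
    exact separates_iff_resRank.1 (hV.separates_pow 2 (Finset.subset_univ Z) (by omega))
  have hker := LinearMap.finrank_range_add_finrank_ker ρ
  have hrange : LinearMap.range φ ≤ (LinearMap.ker ρ).map (V ^ 2).subtype := by
    rintro _ ⟨x, rfl⟩
    have hmem : φ x ∈ V ^ 2 := by
      rw [hφ, pow_two]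
      exact Submodule.sub_mem _ (Submodule.mul_mem_mul hb x.1.2)
        (Submodule.mul_mem_mul ha (hT x.2.2))
    refine ⟨⟨φ x, hmem⟩, ?_, rfl⟩
    ext z
    change φ x z = 0
    simp [hφ, haZ z z.2, hbZ z z.2]
  have hr : Module.finrank K (LinearMap.range φ) ≤ Module.finrank K (LinearMap.ker ρ) :=
    (Submodule.finrank_mono hrange).trans (Submodule.finrank_map_le _ _)
  have hker' := LinearMap.finrank_range_add_finrank_ker φ
  rw [Module.finrank_prod] at hker'
  let ψ : LinearMap.ker φ →ₗ[K] (ι → K) :=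
    (V.subtype ∘ₗ LinearMap.fst K V T).domRestrict (LinearMap.ker φ)
  have hψ : Function.Injective ψ := by
    rw [injective_iff_map_eq_zero]
    rintro ⟨⟨g, f⟩, hx⟩ h0
    have hg : g = 0 := Subtype.ext h0
    have hf : (f : ι → K) = 0 := by
      have haf : a * (f : ι → K) = 0 := by
        have := hφ (g, f)
        rw [LinearMap.mem_ker.1 hx, hg] at this
        simpa using this.symm
      refine hV.eq_zero hdim (hT f.2) (Y := Finset.univ.filter fun x ↦ a x ≠ 0) ?_ ?_
      · have := hV.card_support hdim ha ha0
        omega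
      · intro y hy
        exact (mul_eq_zero.1 (congrFun haf y)).resolve_left (by simpa using hy)
    ext1
    exact Prod.ext hg (Subtype.ext hf)
  refine ⟨LinearMap.range ψ, ?_, ?_, ?_⟩
  · rintro _ ⟨x, rfl⟩
    exact x.1.1.2
  · rw [LinearMap.finrank_range_of_inj hψ]
    omega
  · rintro _ ⟨x, rfl⟩
    refine ⟨x.1.2, x.1.2.2, ?_⟩
    have := hφ x.1
    rw [LinearMap.mem_ker.1 x.2] at this
    exact sub_eq_zero.1 this.symm

theorem GeneralPosition.exists_chain (hV : GeneralPosition V n Finset.univ)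
    (hdim : Module.finrank K V = n + 1)
    (h2 : Module.finrank K (V ^ 2 : Submodule K (ι → K)) ≤ 2 * n + 1)
    (hcard : 2 * n + 1 ≤ Fintype.card ι) {Z : Finset ι} (hZ : Z.card + 1 = n) {a b : ι → K}
    (ha : a ∈ V) (hb : b ∈ V) (ha0 : a ≠ 0) (haZ : ∀ z ∈ Z, a z = 0) (hbZ : ∀ z ∈ Z, b z = 0) :
    ∃ w : ℕ → ι → K, w 0 ≠ 0 ∧ (∀ i ≤ n, w i ∈ V) ∧ ∀ i < n, b * w i = a * w (i + 1) := by
  have key : ∀ k, ∃ T ≤ V, n + 1 ≤ Module.finrank K T + k ∧ ∀ g ∈ T, ∃ w : ℕ → ι → K,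
      w 0 = g ∧ (∀ i ≤ k, w i ∈ V) ∧ ∀ i < k, b * w i = a * w (i + 1) := by
    intro k
    induction k with
    | zero =>
      exact ⟨V, le_rfl, by omega, fun g hg ↦ ⟨fun _ ↦ g, rfl, fun _ _ ↦ hg, by simp⟩⟩
    | succ k ih =>
      obtain ⟨T, hT, hTd, hTw⟩ := ih
      obtain ⟨T', hT', hTd', hf⟩ := hV.exists_submodule hdim h2 hcard hZ ha hb ha0 haZ hbZ hT
      refine ⟨T', hT', by omega, fun g hg ↦ ?_⟩
      obtain ⟨f, hf, hgf⟩ := hf g hg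
      obtain ⟨w, rfl, hwV, hw⟩ := hTw f hf
      refine ⟨fun i ↦ Nat.casesOn i g w, rfl, fun i hi ↦ ?_, fun i hi ↦ ?_⟩
      · cases i with
        | zero => exact hT' hg
        | succ i => exact hwV i (by omega)
      · cases i with
        | zero => exact hgf
        | succ i => exact hw i (by omega)
  obtain ⟨T, -, hTd, hTw⟩ := key n
  have : Nontrivial T := Module.nontrivial_of_finrank_pos (R := K) (by omega)
  obtain ⟨g, hg⟩ := exists_ne (0 : T)
  obtain ⟨w, hw0, hw⟩ := hTw g g.2
  exact ⟨w, fun h ↦ hg (Subtype.ext (hw0.symm.trans h)), hw⟩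

/-- Castelnuovo's lemma: points in general position which impose the minimal number of conditions
on quadrics lie on a rational normal curve, hence have minimal Hilbert function. -/
theorem GeneralPosition.finrank_pow_le (hn : 1 ≤ n) (hV : GeneralPosition V n Finset.univ)
    (hdim : Module.finrank K V = n + 1)
    (h2 : Module.finrank K (V ^ 2 : Submodule K (ι → K)) ≤ 2 * n + 1)
    (hcard : 3 * n + 1 ≤ Fintype.card ι) (q : ℕ) :
    Module.finrank K (V ^ q : Submodule K (ι → K)) ≤ n * q + 1 := by
  obtain ⟨P, -, hP⟩ := Finset.exists_subset_card_eq (s := (Finset.univ : Finset ι)) (n := n + 1)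
    (by rw [Finset.card_univ]; omega)
  obtain ⟨x₁, hx₁⟩ := Finset.card_pos.1 (by omega : 0 < P.card)
  obtain ⟨x₂, hx₂⟩ := Finset.card_pos.1
    (by rw [Finset.card_erase_of_mem hx₁]; omega : 0 < (P.erase x₁).card)
  have hc₁ : (P.erase x₁).card = n := by rw [Finset.card_erase_of_mem hx₁]; omega
  have hc₂ : (P.erase x₂).card = n := by
    rw [Finset.card_erase_of_mem (Finset.mem_of_mem_erase hx₂)]
    omega
  set Z := (P.erase x₁).erase x₂ with hZdef
  have hZ : Z.card + 1 = n := by rw [Finset.card_erase_of_mem hx₂]; omega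
  obtain ⟨b, hb, hbP, hbx⟩ := hV (P.erase x₁) (Finset.subset_univ _) hc₁.le x₁
    (Finset.mem_univ _) (by simp)
  obtain ⟨a, ha, haP, hax⟩ := hV (P.erase x₂) (Finset.subset_univ _) hc₂.le x₂
    (Finset.mem_univ _) (by simp)
  have hax₁ : a x₁ = 0 := haP x₁ (Finset.mem_erase.2 ⟨(Finset.ne_of_mem_erase hx₂).symm, hx₁⟩)
  have ha0 : a ≠ 0 := fun h ↦ hax (congrFun h x₂)
  have hbZ : ∀ z ∈ Z, b z = 0 := fun z hz ↦ hbP z (Finset.mem_of_mem_erase hz)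
  have haZ : ∀ z ∈ Z, a z = 0 := fun z hz ↦ haP z (Finset.mem_erase.2
    ⟨Finset.ne_of_mem_erase hz, Finset.mem_of_mem_erase (Finset.mem_of_mem_erase hz)⟩)
  obtain ⟨w, hw0, hwV, hw⟩ := hV.exists_chain hdim h2 (by omega) hZ ha hb ha0 haZ hbZ
  have hpow : ∀ x, a x ≠ 0 → ∀ i ≤ n, w i x = w 0 x * (b x / a x) ^ i := by
    intro x hx i hi
    induction i with
    | zero => simp
    | succ i ih =>
      have := congrFun (hw i (by omega)) x
      simp only [Pi.mul_apply, ih (by omega)] at this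
      apply mul_left_cancel₀ hx
      rw [← this, pow_succ]
      field_simp
  have hminors : ∀ i < n, ∀ j < n, w i * w (j + 1) = w (i + 1) * w j := by
    intro i hi j hj
    obtain ⟨Y, hY, hYc⟩ := Finset.exists_subset_card_eq
      (s := Finset.univ.filter fun x ↦ a x ≠ 0) (n := 2 * n + 1) (by
        have := hV.card_support hdim ha ha0
        omega)
    rw [← sub_eq_zero]
    refine (hV.separates_pow 2 (Finset.subset_univ Y) (by omega)).eq_zero (by omega) ?_ ?_
    · rw [pow_two]
      exact Submodule.sub_mem _ (Submodule.mul_mem_mul (hwV _ hi.le) (hwV _ hj))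
        (Submodule.mul_mem_mul (hwV _ hi) (hwV _ hj.le))
    · intro y hy
      have hay : a y ≠ 0 := by simpa using hY hy
      simp only [Pi.sub_apply, Pi.mul_apply, hpow y hay _ hi.le, hpow y hay _ hj.le,
        hpow y hay _ (show i + 1 ≤ n from hi), hpow y hay _ (show j + 1 ≤ n from hj)]
      ring
  have hli : LinearIndependent K (fun i : Fin (n + 1) ↦ (⟨w i, hwV i (by omega)⟩ : V)) := by
    rw [Fintype.linearIndependent_iff]
    intro g hg
    have hg' : ∑ i : Fin (n + 1), g i • w i = 0 := by simpa using congrArg V.subtype hg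
    let p : Polynomial K := ∑ i : Fin (n + 1), Polynomial.monomial i (g i)
    have hdeg : p.natDegree < n + 1 := by
      refine Nat.lt_succ_of_le (Polynomial.natDegree_sum_le_of_forall_le _ _ fun i _ ↦ ?_)
      exact (Polynomial.natDegree_monomial_le _).trans (by omega)
    have hp : p = 0 := by
      refine Polynomial.eq_zero_of_natDegree_lt_card_of_eval_eq_zero' p
        ((Finset.univ.filter fun x ↦ a x ≠ 0 ∧ w 0 x ≠ 0).image fun x ↦ b x / a x) ?_ ?_
      · intro t ht
        obtain ⟨x, hx, rfl⟩ := Finset.mem_image.1 ht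
        simp only [Finset.mem_filter, Finset.mem_univ, true_and] at hx
        have := congrFun hg' x
        simp only [Finset.sum_apply, Pi.smul_apply, smul_eq_mul, Pi.zero_apply] at this
        apply mul_left_cancel₀ hx.2
        rw [mul_zero, ← this, Polynomial.eval_finsetSum, Finset.mul_sum]
        refine Finset.sum_congr rfl fun i _ ↦ ?_
        rw [Polynomial.eval_monomial, hpow x hx.1 i (by omega)]
        ring
      · rw [Finset.card_image_of_injOn]
        · have h1 := hV.card_support hdim ha ha0
          have h2 := hV.card_support hdim (hwV 0 (by omega)) hw0
          have h3 := Finset.card_union_add_card_inter (Finset.univ.filter fun x ↦ a x ≠ 0)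
            (Finset.univ.filter fun x ↦ w 0 x ≠ 0)
          have h4 := Finset.card_le_univ ((Finset.univ.filter fun x ↦ a x ≠ 0) ∪
            (Finset.univ.filter fun x ↦ w 0 x ≠ 0))
          rw [← Finset.filter_and] at h3
          omega
        · intro x hx y hy hxy
          simp only [Finset.coe_filter, Finset.mem_univ, true_and, Set.mem_ofPred_eq] at hx hy
          by_contra hne
          have hxZ : x ∉ Z := fun h ↦ hx.1 (haZ x h)
          have hyZ : y ∉ insert x Z := by
            rw [Finset.mem_insert, not_or]
            exact ⟨Ne.symm hne, fun h ↦ hy.1 (haZ y h)⟩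
          have h0 : b - (b x / a x) • a = 0 := by
            refine hV.eq_zero hdim (V.sub_mem hb (V.smul_mem _ ha))
              (Y := insert y (insert x Z)) ?_ ?_
            · rw [Finset.card_insert_of_notMem hyZ, Finset.card_insert_of_notMem hxZ]
              omega
            · intro z hz
              simp only [Finset.mem_insert] at hz
              rcases hz with rfl | rfl | hz
              · have : b x / a x = b z / a z := hxy
                simp [this, hy.1]
              · simp [hx.1]
              · simp [haZ z hz, hbZ z hz]
          have := congrFun h0 x₁
          simp [hax₁, hbx] at this
    intro i
    have := congrArg (fun p ↦ Polynomial.coeff p i) hp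
    simpa [p, Polynomial.finsetSum_coeff, Polynomial.coeff_monomial, Fin.val_inj] using this
  refine finrank_pow_le_of_minors hminors ?_ q
  have htop := hli.span_eq_top_of_card_eq_finrank' (by simp [hdim])
  intro f hf
  have hmem : (⟨f, hf⟩ : V) ∈ Submodule.span K
    (Set.range fun i : Fin (n + 1) ↦ (⟨w i, hwV i (by omega)⟩ : V)) := htop ▸ Submodule.mem_top
  have := Submodule.mem_map_of_mem (f := V.subtype) hmem
  rw [Submodule.map_span] at this
  refine Submodule.span_mono ?_ this
  rintro _ ⟨_, ⟨i, rfl⟩, rfl⟩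
  exact ⟨i, by simp; omega, rfl⟩

end RationalNormalCurve

section Projective

variable {K : Type} [Field K] {n : ℕ}

/-- Evaluation of polynomials at the chosen representatives of the points of `ℙ^n`. -/
noncomputable def evalHom (K : Type) [Field K] (n : ℕ) :
    MvPolynomial (Fin (n+1)) K →ₐ[K] (Projectivization K (Fin (n+1) → K) → K) :=
  MvPolynomial.aeval fun i P ↦ P.rep i

/-- The space of linear forms, as functions on the representatives of the points of `ℙ^n`. -/
noncomputable def linForms (K : Type) [Field K] (n : ℕ) :
    Submodule K (Projectivization K (Fin (n+1) → K) → K) :=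
  (homogeneousSubmodule (Fin (n+1)) K 1).map (evalHom K n).toLinearMap

theorem evalHom_apply (f : MvPolynomial (Fin (n+1)) K) (P : Projectivization K (Fin (n+1) → K)) :
    evalHom K n f P = eval P.rep f := by
  induction f using MvPolynomial.induction_on with
  | C a => simp [evalHom]
  | add p q hp hq => simp [map_add, hp, hq]
  | mul_X p i hp =>
    rw [map_mul, map_mul, Pi.mul_apply, hp, eval_X, evalHom, aeval_X]

theorem linForms_pow (m : ℕ) :
    linForms K n ^ m = (homogeneousSubmodule (Fin (n+1)) K m).map (evalHom K n).toLinearMap := by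
  rw [linForms, ← Submodule.map_pow, homogeneousSubmodule_one_pow]

theorem mem_linForms_pow {m : ℕ} {g : Projectivization K (Fin (n+1) → K) → K} :
    g ∈ linForms K n ^ m ↔ ∃ f : MvPolynomial (Fin (n+1)) K, f.IsHomogeneous m ∧
      ∀ P : Projectivization K (Fin (n+1) → K), eval P.rep f = g P := by
  rw [linForms_pow]
  constructor
  · rintro ⟨f, hf, rfl⟩
    refine ⟨f, hf, fun P ↦ ?_⟩
    rw [← evalHom_apply]
    rfl
  · rintro ⟨f, hf, h⟩
    refine ⟨f, hf, funext fun P ↦ ?_⟩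
    rw [← h P, ← evalHom_apply]
    rfl

theorem eval_smul_of_isHomogeneous {m : ℕ} {f : MvPolynomial (Fin (n+1)) K}
    (hf : f.IsHomogeneous m) (c : K) (x : Fin (n+1) → K) :
    eval (c • x) f = c ^ m * eval x f := by
  rw [eval_eq', eval_eq', Finset.mul_sum]
  refine Finset.sum_congr rfl fun d hd ↦ ?_
  have hdeg : ∑ i, d i = m := by
    rw [← hf (mem_support_iff.1 hd), Finsupp.weight_apply, Finsupp.sum_fintype _ _ (by simp)]
    simp
  simp only [Pi.smul_apply, smul_eq_mul, mul_pow, Finset.prod_mul_distrib,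
    Finset.prod_pow_eq_pow_sum, hdeg]
  ring

theorem mem_idealOfFinset {m : ℕ} {f : MvPolynomial (Fin (n+1)) K} (hf : f.IsHomogeneous m)
    (S : Finset (Projectivization K (Fin (n+1) → K))) :
    f ∈ idealOfFinset S ↔ ∀ P ∈ S, eval P.rep f = 0 := by
  simp only [idealOfFinset, pointIdeal, Submodule.mem_iInf, RingHom.mem_ker]
  refine ⟨fun h P hP ↦ by simpa using h P hP 1, fun h P hP c ↦ ?_⟩
  rw [eval_smul_of_isHomogeneous hf, h P hP, mul_zero]

theorem finrank_map_eq_of_ker {M N N' : Type*} [AddCommGroup M] [Module K M] [AddCommGroup N]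
    [Module K N] [AddCommGroup N'] [Module K N'] (f : M →ₗ[K] N) (g : M →ₗ[K] N')
    (U : Submodule K M) (h : ∀ x ∈ U, f x = 0 ↔ g x = 0) :
    Module.finrank K (U.map f) = Module.finrank K (U.map g) := by
  have hker : LinearMap.ker (f.domRestrict U) = LinearMap.ker (g.domRestrict U) := by
    ext x
    exact h x x.2
  rw [← LinearMap.range_domRestrict, ← LinearMap.range_domRestrict]
  exact ((f.domRestrict U).quotKerEquivRange.symm.trans
    ((Submodule.quotEquivOfEq _ _ hker).trans (g.domRestrict U).quotKerEquivRange)).finrank_eq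

theorem hilbF_eq_resRank {I : Ideal (MvPolynomial (Fin (n+1)) K)} {m : ℕ}
    {Y : Finset (Projectivization K (Fin (n+1) → K))}
    (h : ∀ f : MvPolynomial (Fin (n+1)) K, f.IsHomogeneous m →
      (f ∈ I ↔ ∀ P ∈ Y, eval P.rep f = 0)) :
    hilbF I m = resRank (linForms K n ^ m) Y := by
  rw [resRank, linForms_pow, ← Submodule.map_comp]
  refine finrank_map_eq_of_ker _ _ _ fun f hf ↦ ?_
  have : Ideal.Quotient.mkₐ K I f = 0 ↔ f ∈ I := Ideal.Quotient.eq_zero_iff_mem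
  refine this.trans ((h f hf).trans ⟨fun h ↦ funext fun P ↦ ?_, fun h P hP ↦ ?_⟩)
  · exact (evalHom_apply f P.1).trans (h P P.2)
  · exact (evalHom_apply f P).symm.trans (congrFun h ⟨P, hP⟩)

theorem hilbF_idealOfFinset (Y : Finset (Projectivization K (Fin (n+1) → K))) (m : ℕ) :
    hilbF (idealOfFinset Y) m = resRank (linForms K n ^ m) Y :=
  hilbF_eq_resRank fun _ hf ↦ mem_idealOfFinset hf Y

theorem schemeDeg_eq {I : Ideal (MvPolynomial (Fin (n+1)) K)} {d : ℕ}
    (h : ∀ᶠ m : ℕ in atTop, hilbF I m = d) : schemeDeg I = d := by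
  have hex : ∃ d : ℕ, ∀ᶠ m : ℕ in atTop, hilbF I m = d := ⟨d, h⟩
  rw [schemeDeg, dif_pos hex]
  obtain ⟨m, h1, h2⟩ := (hex.choose_spec.and h).exists
  exact h1.symm.trans h2

theorem exists_linForm_ne_zero (P : Projectivization K (Fin (n+1) → K)) :
    ∃ i, P.rep i ≠ 0 := Function.ne_iff.1 P.rep_nonzero

theorem generalPosition_one (Y : Finset (Projectivization K (Fin (n+1) → K))) :
    GeneralPosition (linForms K n) 1 Y := by
  intro Z _ hZ p _ hp
  rw [← pow_one (linForms K n)]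
  obtain ⟨i, hi⟩ := exists_linForm_ne_zero p
  rcases Z.eq_empty_or_nonempty with rfl | ⟨z, hz⟩
  · exact ⟨fun P ↦ P.rep i, mem_linForms_pow.2 ⟨X i, isHomogeneous_X K i, by simp⟩, by simp, hi⟩
  · have hZz : ∀ y ∈ Z, y = z := fun y hy ↦ Finset.card_le_one.1 hZ y hy z hz
    obtain ⟨j, hj⟩ := exists_linForm_ne_zero z
    by_contra! hcon
    have key : ∀ k l, z.rep k * p.rep l = z.rep l * p.rep k := by
      intro k l
      have := hcon (fun P ↦ z.rep k * P.rep l - z.rep l * P.rep k) (mem_linForms_pow.2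
        ⟨C (z.rep k) * X l - C (z.rep l) * X k, ?_, by simp⟩) ?_
      · exact sub_eq_zero.1 this
      · exact ((isHomogeneous_X K l).C_mul _).sub ((isHomogeneous_X K k).C_mul _)
      · intro y hy
        rw [hZz y hy]
        ring
    apply hp
    have : p = z := by
      rw [← p.mk_rep, ← z.mk_rep, Projectivization.mk_eq_mk_iff']
      refine ⟨p.rep j / z.rep j, funext fun k ↦ ?_⟩
      have := key j k
      simp only [Pi.smul_apply, smul_eq_mul]
      field_simp
      linear_combination -this
    exact this ▸ hz

theorem separates_linForms_pow {Y : Finset (Projectivization K (Fin (n+1) → K))} {m : ℕ}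
    (hm : Y.card ≤ m + 1) : Separates (linForms K n ^ m) Y :=
  (generalPosition_one Y).separates_pow m subset_rfl (by omega)

theorem schemeDeg_of_forall {I : Ideal (MvPolynomial (Fin (n+1)) K)}
    {Y : Finset (Projectivization K (Fin (n+1) → K))} {m₀ : ℕ}
    (h : ∀ m, m₀ ≤ m → ∀ f : MvPolynomial (Fin (n+1)) K, f.IsHomogeneous m →
      (f ∈ I ↔ ∀ P ∈ Y, eval P.rep f = 0)) : schemeDeg I = Y.card := by
  refine schemeDeg_eq (eventually_atTop.2 ⟨max m₀ Y.card, fun m hm ↦ ?_⟩)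
  rw [hilbF_eq_resRank (h m (by omega)), ← separates_iff_resRank]
  exact separates_linForms_pow (by omega)

theorem schemeDeg_idealOfFinset (Y : Finset (Projectivization K (Fin (n+1) → K))) :
    schemeDeg (idealOfFinset Y) = Y.card :=
  schemeDeg_of_forall (m₀ := 0) fun _ _ _ hf ↦ mem_idealOfFinset hf Y

theorem le_saturate (I : Ideal (MvPolynomial (Fin (n+1)) K)) : I ≤ saturate I :=
  Ideal.le_colon.trans (le_iSup (fun k : ℕ ↦ Submodule.colon I
    ((irrelevantIdeal K n ^ k : Ideal (MvPolynomial (Fin (n+1)) K)) :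
      Set (MvPolynomial (Fin (n+1)) K))) 0)

theorem saturate_le_ker_eval {I : Ideal (MvPolynomial (Fin (n+1)) K)}
    (P : Projectivization K (Fin (n+1) → K)) (hI : I ≤ RingHom.ker (eval P.rep)) :
    saturate I ≤ RingHom.ker (eval P.rep) := by
  refine iSup_le fun k f hf ↦ ?_
  obtain ⟨i, hi⟩ := exists_linForm_ne_zero P
  have hX : (X i : MvPolynomial (Fin (n+1)) K) ^ k ∈ irrelevantIdeal K n ^ k :=
    Ideal.pow_mem_pow (Ideal.subset_span (Set.mem_range_self i)) k
  have := hI (Submodule.mem_colon.1 hf _ hX)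
  rw [RingHom.mem_ker, smul_eq_mul, map_mul, map_pow, eval_X] at this
  exact (mul_eq_zero.1 this).resolve_right (pow_ne_zero k hi)

theorem schemeDeg_interIdeal (S : Finset (Projectivization K (Fin (n+1) → K)))
    (W : Submodule K (MvPolynomial (Fin (n+1)) K))
    (hW : W ≤ homogeneousSubmodule (Fin (n+1)) K 1) :
    schemeDeg (interIdeal (idealOfFinset S) (Ideal.span (W : Set (MvPolynomial (Fin (n+1)) K)))) =
      (S.filter fun P ↦ ∀ L ∈ W, eval P.rep L = 0).card := by
  refine schemeDeg_of_forall (m₀ := S.card + 1) fun m hm f hf ↦ ⟨fun hfI P hP ↦ ?_, fun h ↦ ?_⟩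
  · rw [Finset.mem_filter] at hP
    refine saturate_le_ker_eval P (sup_le ?_ (Ideal.span_le.2 fun L hL ↦ hP.2 L hL)) hfI
    intro g hg
    simp only [idealOfFinset, pointIdeal, Submodule.mem_iInf, RingHom.mem_ker] at hg
    simpa using hg P hP.1 1
  · obtain ⟨k, rfl⟩ : ∃ k, m = k + 1 := ⟨m - 1, by omega⟩
    have key : ∀ P ∈ S, ∃ g ∈ Ideal.span (W : Set (MvPolynomial (Fin (n+1)) K)),
        g.IsHomogeneous (k + 1) ∧ eval P.rep g = eval P.rep f ∧
        ∀ Q ∈ S, Q ≠ P → eval Q.rep g = 0 := by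
      intro P hP
      by_cases hPW : ∀ L ∈ W, eval P.rep L = 0
      · refine ⟨0, Ideal.zero_mem _, isHomogeneous_zero _ _ _, ?_, by simp⟩
        rw [h P (Finset.mem_filter.2 ⟨hP, hPW⟩), map_zero]
      · push Not at hPW
        obtain ⟨L, hL, hLP⟩ := hPW
        obtain ⟨_, hF, hFP, hF0⟩ := separates_linForms_pow (m := k) (Y := S) (by omega) P hP
        obtain ⟨F, hFh, hFe⟩ := mem_linForms_pow.1 hF
        simp only [← hFe] at hFP hF0
        refine ⟨C (eval P.rep f / (eval P.rep F * eval P.rep L)) * (F * L),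
          Ideal.mul_mem_left _ _ (Ideal.mul_mem_left _ _ (Ideal.subset_span hL)),
          (hFh.mul (hW hL)).C_mul _, ?_, fun Q hQ hQP ↦ ?_⟩
        · simp only [map_mul, eval_C]
          exact div_mul_cancel₀ _ (mul_ne_zero hFP hLP)
        · simp [hF0 Q hQ hQP]
    choose! g hgJ hgh hgP hg0 using key
    have hsum : f - ∑ P ∈ S, g P ∈ idealOfFinset S := by
      rw [mem_idealOfFinset (hf.sub (IsHomogeneous.sum _ _ _ fun P hP ↦ hgh P hP))]
      intro P hP
      rw [map_sub, map_sum, Finset.sum_eq_single P (fun Q hQ hQP ↦ hg0 Q hQ P hP hQP.symm)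
        (fun h ↦ absurd hP h), hgP P hP, sub_self]
    apply le_saturate
    rw [← sub_add_cancel f (∑ P ∈ S, g P)]
    exact Ideal.add_mem _ (Ideal.mem_sup_left hsum)
      (Ideal.mem_sup_right (Ideal.sum_mem _ fun P hP ↦ hgJ P hP))

theorem finrank_homogeneousSubmodule_one :
    Module.finrank K (homogeneousSubmodule (Fin (n+1)) K 1) = n + 1 := by
  rw [homogeneousSubmodule_one_eq_span_X, finrank_span_eq_card (linearIndependent_X _ _),
    Fintype.card_fin]

instance : Module.Finite K (homogeneousSubmodule (Fin (n+1)) K 1) :=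
  Module.finite_of_finrank_pos (by rw [finrank_homogeneousSubmodule_one]; omega)

instance : Module.Finite K (linForms K n) := by
  unfold linForms
  infer_instance

theorem InLinGenPos.generalPosition {S : Finset (Projectivization K (Fin (n+1) → K))}
    (h : InLinGenPos (idealOfFinset S)) : GeneralPosition (linForms K n) n S := by
  intro Z hZS hZ p hpS hpZ
  by_contra! hcon
  let ρ : MvPolynomial (Fin (n+1)) K →ₗ[K] (Z → K) :=
    (resHom K Z).toLinearMap ∘ₗ (evalHom K n).toLinearMap
  have hρ : ∀ f (z : Z), ρ f z = eval z.1.rep f := fun f z ↦ evalHom_apply f z.1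
  let σ := ρ.domRestrict (homogeneousSubmodule (Fin (n+1)) K 1)
  let W : Submodule K (MvPolynomial (Fin (n+1)) K) :=
    (LinearMap.ker σ).map (homogeneousSubmodule (Fin (n+1)) K 1).subtype
  have hW : W ≤ homogeneousSubmodule (Fin (n+1)) K 1 := by
    rintro _ ⟨x, -, rfl⟩
    exact x.2
  have hWZ : ∀ L ∈ W, ∀ z ∈ Z, eval z.rep L = 0 := by
    rintro _ ⟨x, hx, rfl⟩ z hz
    exact (hρ _ ⟨z, hz⟩).symm.trans (congrFun hx ⟨z, hz⟩)
  have hWp : ∀ L ∈ W, eval p.rep L = 0 := by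
    intro L hL
    refine hcon (fun P ↦ eval P.rep L) ?_ fun z hz ↦ hWZ L hL z hz
    rw [← pow_one (linForms K n)]
    exact mem_linForms_pow.2 ⟨L, hW hL, fun _ ↦ rfl⟩
  have hWle : Module.finrank K W ≤ n := by
    have hlt : W < homogeneousSubmodule (Fin (n+1)) K 1 := by
      refine hW.lt_of_ne fun heq ↦ ?_
      obtain ⟨i, hi⟩ := exists_linForm_ne_zero p
      exact hi (by simpa using hWp (X i) (heq ▸ isHomogeneous_X K i))
    have := Submodule.finrank_lt_finrank_of_lt hlt
    rw [finrank_homogeneousSubmodule_one] at this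
    omega
  have hWge : n + 1 ≤ Module.finrank K W + Z.card := by
    have h1 := LinearMap.finrank_range_add_finrank_ker σ
    have h2 := Submodule.finrank_le (LinearMap.range σ)
    have h3 : Module.finrank K W = Module.finrank K (LinearMap.ker σ) :=
      Submodule.finrank_map_subtype_eq _ _
    rw [finrank_homogeneousSubmodule_one] at h1
    rw [Module.finrank_pi, Fintype.card_coe] at h2
    omega
  have hsec : HasSecantPlane (idealOfFinset S) (n - Module.finrank K W) := by
    refine ⟨_, ⟨W, hW, by omega, rfl⟩, ?_⟩
    rw [schemeDeg_interIdeal S W hW]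
    have : insert p Z ⊆ S.filter fun P ↦ ∀ L ∈ W, eval P.rep L = 0 := by
      intro P hP
      rcases Finset.mem_insert.1 hP with rfl | hP
      · exact Finset.mem_filter.2 ⟨hpS, hWp⟩
      · exact Finset.mem_filter.2 ⟨hZS hP, fun L hL ↦ hWZ L hL P hP⟩
    have := Finset.card_le_card this
    rw [Finset.card_insert_of_notMem hpZ] at this
    omega
  have : tInv (idealOfFinset S) ≤ n - Module.finrank K W := Nat.sInf_le hsec
  rw [InLinGenPos] at h
  omega

theorem finrank_pow_resRank_le {S : Finset (Projectivization K (Fin (n+1) → K))} (hn : 1 ≤ n)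
    (hV : GeneralPosition (linForms K n) n S) (h2 : resRank (linForms K n ^ 2) S ≤ 2 * n + 1)
    (hcard : 3 * n + 1 ≤ S.card) (q : ℕ) : resRank (linForms K n ^ q) S ≤ n * q + 1 := by
  have hpow : ∀ q, resRank (linForms K n ^ q) S =
      Module.finrank K ((linForms K n).map (resHom K S).toLinearMap ^ q :
        Submodule K (S → K)) := by
    intro q
    rw [resRank, Submodule.map_pow]
  rw [hpow] at h2 ⊢
  refine GeneralPosition.finrank_pow_le hn ?_ ?_ h2 (by rwa [Fintype.card_coe]) q
  · intro Z _ hZ p _ hp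
    obtain ⟨L, hL, hL0, hLp⟩ := hV (Z.map (Function.Embedding.subtype _))
      (fun x hx ↦ by
        obtain ⟨y, -, rfl⟩ := Finset.mem_map.1 hx
        exact y.2)
      (by rwa [Finset.card_map]) p p.2 (by simpa using hp)
    exact ⟨_, ⟨L, hL, rfl⟩, fun z hz ↦ hL0 z (Finset.mem_map_of_mem _ hz), hLp⟩
  · obtain ⟨Y, hY, hYc⟩ := Finset.exists_subset_card_eq (s := S) (n := n + 1) (by omega)
    refine le_antisymm ?_ ?_
    · refine (Submodule.finrank_map_le (resHom K S).toLinearMap (linForms K n)).trans ?_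
      exact (Submodule.finrank_map_le (evalHom K n).toLinearMap
        (homogeneousSubmodule (Fin (n+1)) K 1)).trans finrank_homogeneousSubmodule_one.le
    · have := (hV.separates_pow 1 hY (by omega)).card_le hY
      rwa [hYc, hpow, pow_one] at this

end Projective


/-- Theorem 5.5, the second equivalence. -/
theorem stmt18 (K : Type) [Field K] [IsAlgClosed K] [CharZero K] (n d q r : ℕ) (hn : 2 ≤ n)
    (S : Finset (Projectivization K (Fin (n+1) → K)))
    (hcard : S.card = d)
    (hlgp : InLinGenPos (idealOfFinset S))
    (hd : 4*n^2 + 6*n + 1 ≤ d)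
    (hdqr : d = n*q + r + 2) (hr : r ≤ n - 1)
    (hpos : 0 < h1F (idealOfFinset S) q) :
    UniformPosition S ↔ h1F (idealOfFinset S) q = r + 1 := by
  have hV := hlgp.generalPosition
  have hq : 4 * n + 4 ≤ q := by
    by_contra! h
    nlinarith [Nat.mul_le_mul_left n (Nat.lt_succ_iff.1 h), Nat.sub_le n 1]
  simp only [h1F, UniformPosition, schemeDeg_idealOfFinset, hilbF_idealOfFinset, hcard] at hpos ⊢
  have hlow : ∀ ℓ, n * ℓ + 1 ≤ d → n * ℓ + 1 ≤ resRank (linForms K n ^ ℓ) S := by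
    intro ℓ hℓ
    obtain ⟨Y, hY, hYc⟩ := Finset.exists_subset_card_eq (hcard ▸ hℓ)
    exact hYc ▸ (hV.separates_pow ℓ hY hYc.le).card_le hY
  have hlowq := hlow q (by omega)
  constructor
  · intro hU
    have hsep : ∀ ℓ, ∀ Y ⊆ S, Y.card ≤ resRank (linForms K n ^ ℓ) S →
        Separates (linForms K n ^ ℓ) Y := fun ℓ Y hY hYc ↦
      separates_iff_resRank.2 ((hU Y hY ℓ).trans (min_eq_left hYc))
    have hrpos : ∀ ℓ, 0 < resRank (linForms K n ^ ℓ) S := by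
      intro ℓ
      obtain ⟨P, hP⟩ := Finset.card_pos.1 (by omega : 0 < S.card)
      have hPS := Finset.singleton_subset_iff.2 hP
      exact (hV.separates_pow ℓ hPS (by simp)).card_le hPS
    have h2 : resRank (linForms K n ^ 2) S ≤ 2 * n + 1 := by
      by_contra! h2
      have hm := resRank_mul_of_forall_separates hsep hrpos (c := 2 * n + 1) (k := 2) h2 (q / 2)
      have hs := hV.resRank_succ (2 * (q / 2))
      rcases Nat.even_or_odd' q with ⟨m, rfl | rfl⟩
      · rw [Nat.mul_div_cancel_left m two_pos] at hm
        have : m * (2 * n + 1) + 1 = n * (2 * m) + m + 1 := by ring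
        omega
      · have hdiv : (2 * m + 1) / 2 = m := by omega
        rw [hdiv] at hm hs
        have : m * (2 * n + 1) + 1 + n = n * (2 * m + 1) + m + 1 := by ring
        omega
    have := finrank_pow_resRank_le (by omega) hV h2 (by nlinarith) q
    omega
  · intro h1 Y hY ℓ
    have hup : ∀ j ℓ, ℓ + j = q → resRank (linForms K n ^ ℓ) S ≤ n * ℓ + 1 := by
      intro j
      induction j with
      | zero =>
        rintro ℓ rfl
        simp only [Nat.add_zero] at *
        omega
      | succ j ih =>
        intro ℓ hℓ
        have ih := ih (ℓ + 1) (by omega)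
        have hs := hV.resRank_succ ℓ
        have := Nat.mul_le_mul_left n (by omega : ℓ + 1 ≤ q)
        rw [Nat.mul_succ] at ih this
        omega
    refine le_antisymm (le_min (resRank_le_card _ _) (resRank_mono _ hY)) ?_
    obtain ⟨Y', hY', hYc⟩ := Finset.exists_subset_card_eq
      (min_le_left Y.card (resRank (linForms K n ^ ℓ) S))
    rw [← hYc]
    refine (hV.separates_pow ℓ (hY'.trans hY) ?_).card_le hY'
    rcases le_or_gt ℓ q with hℓ | hℓ
    · have := hup (q - ℓ) ℓ (by omega)
      omega
    · have h3 := Nat.mul_le_mul_left n (Nat.succ_le_of_lt hℓ)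
      rw [Nat.mul_succ] at h3
      have h4 := Finset.card_le_card hY
      omega
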